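/- arXiv:1907.11827 — 2 statements merged into one kernel-verified Lean document; each statement's English description precedes it below -/
import Mathlib

section
/- Interior elliptic equation for the total pressure (equation (3.2)): Let Ω ⊆ ℝ³ be open, I an interval, and η : I × Ω → ℝ³ be C³ with det D_yη ≡ 1; set v := ∂_tη and a := (D_yη)^{-1} with entries a^{μα}. Let b₀ : Ω → ℝ³ be C², set b(t,y) := D_yη(t,y)·b₀(y), and let Q : I × Ω → ℝ be C². Assume that for all (t,y): (i) ∂_t v_α = Σ_μ b₀^μ ∂_μ b_α − Σ_μ a^{μα} ∂_μ Q; (ii) Σ_{μ,α} a^{μα} ∂_μ v_α = 0; (iii) Σ_{μ,α} a^{μα} ∂_μ b_α = 0. Then pointwise, with Δ = Σ_μ ∂_μ∂_μ: ΔQ = Σ_{ν,α} (∂_t a^{να}) ∂_ν v_α + Σ_{μ,ν} ∂_ν((δ^{μν} − Σ_α a^{μα} a^{να}) ∂_μ Q) + Σ_{ν,α,μ} a^{να} (∂_ν b₀^μ)(∂_μ b_α) + Σ_{β,γ,ν,α} (∂_β b_γ) a^{νγ} a^{βα} (∂_ν b_α) − Σ_{β,μ,α} (∂_β b₀^μ)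 a^{βα} (∂_μ b_α). -/
open scoped BigOperators

/-- Partial derivative in the `μ`-th coordinate direction of a scalar function on `ℝ³`. -/
noncomputable def pd (f : (Fin 3 → ℝ) → ℝ) (μ : Fin 3) (y : Fin 3 → ℝ) : ℝ :=
  fderiv ℝ f y (Pi.single μ 1)

/-- The spatial Jacobian matrix `(D_yη)^α_μ = ∂η^α/∂y^μ` (row `α`, column `μ`). -/
noncomputable def jac (η : (Fin 3 → ℝ) → (Fin 3 → ℝ)) (y : Fin 3 → ℝ) :
    Matrix (Fin 3) (Fin 3) ℝ :=
  Matrix.of fun α μ => pd (fun z => η z α) μ y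

/-- The Lagrangian velocity `v := ∂_tη`. -/
noncomputable def tderiv (η : ℝ → (Fin 3 → ℝ) → (Fin 3 → ℝ)) (t : ℝ) (y : Fin 3 → ℝ) :
    Fin 3 → ℝ :=
  deriv (fun s => η s y) t

section DirectionalDerivative

variable {E : Type*} [NormedAddCommGroup E] [NormedSpace ℝ E]

/-- Derivative of a scalar function in the direction `v`. -/
noncomputable def dirDeriv (v : E) (f : E → ℝ) (p : E) : ℝ := fderiv ℝ f p v

lemma dirDeriv_sub {v : E} {f g : E → ℝ} {p : E} (hf : DifferentiableAt ℝ f p)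
    (hg : DifferentiableAt ℝ g p) :
    dirDeriv v (fun x => f x - g x) p = dirDeriv v f p - dirDeriv v g p := by
  simp [dirDeriv, fderiv_fun_sub hf hg]

lemma dirDeriv_mul {v : E} {f g : E → ℝ} {p : E} (hf : DifferentiableAt ℝ f p)
    (hg : DifferentiableAt ℝ g p) :
    dirDeriv v (fun x => f x * g x) p = dirDeriv v f p * g p + f p * dirDeriv v g p := by
  simp [dirDeriv, fderiv_fun_mul hf hg]
  ring

lemma dirDeriv_sum {ι : Type*} {s : Finset ι} {v : E} {f : ι → E → ℝ} {p : E}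
    (hf : ∀ i ∈ s, DifferentiableAt ℝ (f i) p) :
    dirDeriv v (fun x => ∑ i ∈ s, f i x) p = ∑ i ∈ s, dirDeriv v (f i) p := by
  simp [dirDeriv, fderiv_fun_sum hf]

lemma dirDeriv_congr {U : Set E} (hU : IsOpen U) {v : E} {f g : E → ℝ} (h : Set.EqOn f g U)
    {p : E} (hp : p ∈ U) : dirDeriv v f p = dirDeriv v g p := by
  have : f =ᶠ[nhds p] g := Filter.eventuallyEq_of_mem (hU.mem_nhds hp) h
  simp [dirDeriv, this.fderiv_eq]

lemma dirDeriv_eqOn_const {U : Set E} (hU : IsOpen U) {v : E} {f : E → ℝ} {c : ℝ}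
    (h : ∀ x ∈ U, f x = c) {p : E} (hp : p ∈ U) : dirDeriv v f p = 0 := by
  rw [dirDeriv_congr hU (g := fun _ => c) h hp]
  simp [dirDeriv]

lemma ContDiffOn.dirDeriv {U : Set E} (hU : IsOpen U) {m n : WithTop ℕ∞} {f : E → ℝ}
    (hf : ContDiffOn ℝ n f U) (hmn : m + 1 ≤ n) (v : E) : ContDiffOn ℝ m (dirDeriv v f) U :=
  (hf.fderiv_of_isOpen hU hmn).clm_apply contDiffOn_const

lemma dirDeriv_comm {U : Set E} (hU : IsOpen U) {f : E → ℝ} (hf : ContDiffOn ℝ 2 f U)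
    {p : E} (hp : p ∈ U) (v w : E) :
    dirDeriv v (dirDeriv w f) p = dirDeriv w (dirDeriv v f) p := by
  have hd : DifferentiableAt ℝ (fderiv ℝ f) p :=
    ((hf.fderiv_of_isOpen hU (m := 1) (by norm_num)).differentiableOn (by norm_num)).differentiableAt
      (hU.mem_nhds hp)
  have key : ∀ v w : E, dirDeriv v (dirDeriv w f) p = fderiv ℝ (fderiv ℝ f) p v w := by
    intro v w
    change fderiv ℝ (fun x => fderiv ℝ f x w) p v = _
    rw [fderiv_clm_apply hd (differentiableAt_const w)]
    simp
  rw [key, key]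
  exact ((hf.contDiffAt (hU.mem_nhds hp)).isSymmSndFDerivAt (by simp)).eq v w

lemma ContDiffOn.differentiableAt_of_isOpen {U : Set E} (hU : IsOpen U) {f : E → ℝ}
    {n : WithTop ℕ∞} (hf : ContDiffOn ℝ n f U) (hn : n ≠ 0) {p : E} (hp : p ∈ U) :
    DifferentiableAt ℝ f p :=
  (hf.differentiableOn hn).differentiableAt (hU.mem_nhds hp)

end DirectionalDerivative

section Deformation

variable {E : Type*} [NormedAddCommGroup E] [NormedSpace ℝ E]

/-- The matrix of directional derivatives of `h` along the frame `e`. -/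
noncomputable def frameJac (e : Fin 3 → E) (h : Fin 3 → E → ℝ) (p : E) :
    Matrix (Fin 3) (Fin 3) ℝ :=
  Matrix.of fun α μ => dirDeriv (e μ) (h α) p

variable {U : Set E} {e : Fin 3 → E} {h : Fin 3 → E → ℝ}

lemma frameJac_inv_eq_adjugate (hdet : ∀ p ∈ U, (frameJac e h p).det = 1) {p : E} (hp : p ∈ U) :
    (frameJac e h p)⁻¹ = (frameJac e h p).adjugate := by
  simp [Matrix.inv_def, hdet p hp]

lemma contDiffOn_frameJac_inv (hU : IsOpen U) (hh : ∀ α, ContDiffOn ℝ 3 (h α) U)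
    (hdet : ∀ p ∈ U, (frameJac e h p).det = 1) (ν α : Fin 3) :
    ContDiffOn ℝ 2 (fun p => (frameJac e h p)⁻¹ ν α) U := by
  have hJ : ∀ α μ, ContDiffOn ℝ 2 (dirDeriv (e μ) (h α)) U := fun α μ =>
    (hh α).dirDeriv hU (by norm_num) _
  refine ContDiffOn.congr (f := fun p => (frameJac e h p).adjugate ν α) ?_
    fun p hp => by rw [frameJac_inv_eq_adjugate hdet hp]
  simp only [Matrix.adjugate_fin_three, frameJac, Matrix.of_apply]
  fin_cases ν <;> fin_cases α <;> simp <;>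
    first
    | exact ((hJ _ _).mul (hJ _ _)).sub ((hJ _ _).mul (hJ _ _))
    | exact (((hJ _ _).mul (hJ _ _)).neg).add ((hJ _ _).mul (hJ _ _))

/-- The Piola identity. -/
lemma sum_dirDeriv_frameJac_inv (hU : IsOpen U) (hh : ∀ α, ContDiffOn ℝ 3 (h α) U)
    (hdet : ∀ p ∈ U, (frameJac e h p).det = 1) {p : E} (hp : p ∈ U) (α : Fin 3) :
    ∑ ν, dirDeriv (e ν) (fun x => (frameJac e h x)⁻¹ ν α) p = 0 := by
  have hJ : ∀ α μ, DifferentiableAt ℝ (dirDeriv (e μ) (h α)) p := fun α μ =>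
    ((hh α).dirDeriv hU (m := 2) (by norm_num) _).differentiableAt_of_isOpen hU (by norm_num) hp
  have hc : ∀ α μ ν, dirDeriv (e μ) (dirDeriv (e ν) (h α)) p =
      dirDeriv (e ν) (dirDeriv (e μ) (h α)) p := fun α μ ν =>
    dirDeriv_comm hU ((hh α).of_le (by norm_num)) hp _ _
  have hA : ∀ ν, dirDeriv (e ν) (fun x => (frameJac e h x)⁻¹ ν α) p =
      dirDeriv (e ν) (fun x => (frameJac e h x).adjugate ν α) p := fun ν =>
    dirDeriv_congr hU (fun x hx => by simp only [frameJac_inv_eq_adjugate hdet hx]) hp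
  simp only [hA, Fin.sum_univ_three]
  simp only [Matrix.adjugate_fin_three, frameJac, Matrix.of_apply]
  fin_cases α <;> simp [neg_add_eq_sub] <;>
    rw [dirDeriv_sub (by fun_prop) (by fun_prop), dirDeriv_sub (by fun_prop) (by fun_prop),
      dirDeriv_sub (by fun_prop) (by fun_prop)] <;>
    simp only [dirDeriv_mul (hJ _ _) (hJ _ _)] <;>
    simp only [hc _ 1 0, hc _ 2 0, hc _ 2 1] <;>
    ring

/-- Derivative of the inverse Jacobian, `∂a = -a (∂J) a`. -/
lemma dirDeriv_frameJac_inv (hU : IsOpen U) (hh : ∀ α, ContDiffOn ℝ 3 (h α) U)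
    (hdet : ∀ p ∈ U, (frameJac e h p).det = 1) {p : E} (hp : p ∈ U) (v : E) (ν α : Fin 3) :
    dirDeriv v (fun x => (frameJac e h x)⁻¹ ν α) p =
      -∑ γ, ∑ β, (frameJac e h p)⁻¹ ν γ * dirDeriv v (dirDeriv (e β) (h γ)) p *
        (frameJac e h p)⁻¹ β α := by
  have hJ : ∀ α μ, DifferentiableAt ℝ (fun x => frameJac e h x α μ) p := fun α μ =>
    ((hh α).dirDeriv hU (m := 2) (by norm_num) _).differentiableAt_of_isOpen hU (by norm_num) hp
  have hA : ∀ ν α, DifferentiableAt ℝ (fun x => (frameJac e h x)⁻¹ ν α) p := fun ν α =>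
    (contDiffOn_frameJac_inv hU hh hdet ν α).differentiableAt_of_isOpen hU (by norm_num) hp
  have hdet' : IsUnit (frameJac e h p).det := by rw [hdet p hp]; exact isUnit_one
  let dA : Matrix (Fin 3) (Fin 3) ℝ :=
    Matrix.of fun ν α => dirDeriv v (fun x => (frameJac e h x)⁻¹ ν α) p
  let dJ : Matrix (Fin 3) (Fin 3) ℝ :=
    Matrix.of fun γ β => dirDeriv v (fun x => frameJac e h x γ β) p
  have hprod : dA * frameJac e h p + (frameJac e h p)⁻¹ * dJ = 0 := by
    ext ν β
    have h1 : dirDeriv v (fun x => ∑ γ, (frameJac e h x)⁻¹ ν γ * frameJac e h x γ β) p = 0 :=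
      dirDeriv_eqOn_const hU (c := (1 : Matrix (Fin 3) (Fin 3) ℝ) ν β) (fun x hx => by
        rw [← Matrix.mul_apply, Matrix.nonsing_inv_mul _ (by rw [hdet x hx]; exact isUnit_one)]) hp
    rw [dirDeriv_sum fun γ _ => (hA ν γ).fun_mul (hJ γ β)] at h1
    simp only [dirDeriv_mul (hA _ _) (hJ _ _), Finset.sum_add_distrib] at h1
    simpa [Matrix.mul_apply, dA, dJ] using h1
  have hdA : dA = -((frameJac e h p)⁻¹ * dJ * (frameJac e h p)⁻¹) := by
    rw [← Matrix.mul_nonsing_inv_cancel_right (frameJac e h p) dA hdet',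
      eq_neg_of_add_eq_zero_left hprod, Matrix.neg_mul]
  have := congrFun (congrFun hdA ν) α
  simp only [Matrix.neg_apply, Matrix.mul_apply, Finset.sum_mul] at this
  rw [Finset.sum_comm] at this
  exact this

/-- Differentiated form of the condition that `V` is divergence free with respect to `h`. -/
lemma sum_frameJac_inv_mul_dirDeriv_dirDeriv (hU : IsOpen U) (hh : ∀ α, ContDiffOn ℝ 3 (h α) U)
    (hdet : ∀ p ∈ U, (frameJac e h p).det = 1) {V : Fin 3 → E → ℝ}
    (hV : ∀ α, ContDiffOn ℝ 2 (V α) U)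
    (hdiv : ∀ p ∈ U, ∑ ν, ∑ α, (frameJac e h p)⁻¹ ν α * dirDeriv (e ν) (V α) p = 0)
    {p : E} (hp : p ∈ U) (v : E) :
    ∑ ν, ∑ α, (frameJac e h p)⁻¹ ν α * dirDeriv (e ν) (dirDeriv v (V α)) p =
      -∑ ν, ∑ α, dirDeriv v (fun x => (frameJac e h x)⁻¹ ν α) p * dirDeriv (e ν) (V α) p := by
  have hA : ∀ ν α, DifferentiableAt ℝ (fun x => (frameJac e h x)⁻¹ ν α) p := fun ν α =>
    (contDiffOn_frameJac_inv hU hh hdet ν α).differentiableAt_of_isOpen hU (by norm_num) hp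
  have hdV : ∀ ν α, DifferentiableAt ℝ (dirDeriv (e ν) (V α)) p := fun ν α =>
    ((hV α).dirDeriv hU (m := 1) (by norm_num) _).differentiableAt_of_isOpen hU (by norm_num) hp
  have h0 := dirDeriv_eqOn_const hU (v := v) hdiv hp
  rw [dirDeriv_sum fun ν _ => DifferentiableAt.fun_sum fun α _ =>
    (hA ν α).fun_mul (hdV ν α)] at h0
  simp_rw [dirDeriv_sum fun α _ => (hA _ α).fun_mul (hdV _ α), dirDeriv_mul (hA _ _) (hdV _ _),
    Finset.sum_add_distrib, fun ν α => dirDeriv_comm hU (hV α) hp v (e ν)] at h0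
  linarith

/-- Divergence of the magnetic tension `b₀ ⬝ ∇ B` for a divergence-free field `B = (∇ h) b₀`. -/
lemma sum_frameJac_inv_mul_dirDeriv_tension (hU : IsOpen U)
    (hh : ∀ α, ContDiffOn ℝ 3 (h α) U) (hdet : ∀ p ∈ U, (frameJac e h p).det = 1)
    {b₀ B : Fin 3 → E → ℝ} (hb₀ : ∀ μ, ContDiffOn ℝ 2 (b₀ μ) U)
    (hB : ∀ α, ∀ p ∈ U, B α p = ∑ μ, dirDeriv (e μ) (h α) p * b₀ μ p)
    (hdiv : ∀ p ∈ U, ∑ ν, ∑ α, (frameJac e h p)⁻¹ ν α * dirDeriv (e ν) (B α) p = 0)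
    {p : E} (hp : p ∈ U) :
    ∑ ν, ∑ α, (frameJac e h p)⁻¹ ν α *
        dirDeriv (e ν) (fun x => ∑ μ, b₀ μ x * dirDeriv (e μ) (B α) x) p =
      (∑ ν, ∑ α, ∑ μ, (frameJac e h p)⁻¹ ν α * dirDeriv (e ν) (b₀ μ) p *
          dirDeriv (e μ) (B α) p)
        + (∑ β, ∑ γ, ∑ ν, ∑ α, dirDeriv (e β) (B γ) p * (frameJac e h p)⁻¹ ν γ *
            (frameJac e h p)⁻¹ β α * dirDeriv (e ν) (B α) p)
        - ∑ β, ∑ μ, ∑ α, dirDeriv (e β) (b₀ μ) p * (frameJac e h p)⁻¹ β α *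
            dirDeriv (e μ) (B α) p := by
  have hdh : ∀ α μ, ContDiffOn ℝ 2 (dirDeriv (e μ) (h α)) U := fun α μ =>
    (hh α).dirDeriv hU (by norm_num) _
  have hBC : ∀ α, ContDiffOn ℝ 2 (B α) U := fun α =>
    (ContDiffOn.sum fun μ _ => (hdh α μ).mul (hb₀ μ)).congr (hB α)
  have hdh' : ∀ α μ, DifferentiableAt ℝ (dirDeriv (e μ) (h α)) p := fun α μ =>
    (hdh α μ).differentiableAt_of_isOpen hU (by norm_num) hp
  have hb₀' : ∀ μ, DifferentiableAt ℝ (b₀ μ) p := fun μ =>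
    (hb₀ μ).differentiableAt_of_isOpen hU (by norm_num) hp
  have hdB : ∀ μ α, DifferentiableAt ℝ (dirDeriv (e μ) (B α)) p := fun μ α =>
    ((hBC α).dirDeriv hU (m := 1) (by norm_num) _).differentiableAt_of_isOpen hU (by norm_num) hp
  have hinv : (frameJac e h p)⁻¹ * frameJac e h p = 1 :=
    Matrix.nonsing_inv_mul _ (by rw [hdet p hp]; exact isUnit_one)
  have hcomm : ∀ γ μ β, dirDeriv (e μ) (dirDeriv (e β) (h γ)) p =
      dirDeriv (e β) (dirDeriv (e μ) (h γ)) p := fun γ μ β =>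
    dirDeriv_comm hU ((hh γ).of_le (by norm_num)) hp _ _
  have hgradB : ∀ β γ, dirDeriv (e β) (B γ) p =
      ∑ μ, dirDeriv (e β) (dirDeriv (e μ) (h γ)) p * b₀ μ p +
        ∑ μ, frameJac e h p γ μ * dirDeriv (e β) (b₀ μ) p := fun β γ => by
    rw [dirDeriv_congr hU (hB γ) hp, dirDeriv_sum fun μ _ => (hdh' γ μ).fun_mul (hb₀' μ)]
    simp only [dirDeriv_mul (hdh' _ _) (hb₀' _), Finset.sum_add_distrib]
    rfl
  have hstretch : ∀ ν β,
      ∑ γ, (frameJac e h p)⁻¹ ν γ * dirDeriv (e β) (B γ) p - dirDeriv (e β) (b₀ ν) p =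
      ∑ μ, b₀ μ p * ∑ γ, (frameJac e h p)⁻¹ ν γ * dirDeriv (e μ) (dirDeriv (e β) (h γ)) p := by
    intro ν β
    have hδ : ∑ γ, (frameJac e h p)⁻¹ ν γ * ∑ μ, frameJac e h p γ μ * dirDeriv (e β) (b₀ μ) p =
        dirDeriv (e β) (b₀ ν) p := by
      have := congrFun (Matrix.mulVec_mulVec (fun μ => dirDeriv (e β) (b₀ μ) p)
        (frameJac e h p)⁻¹ (frameJac e h p)) ν
      rw [hinv, Matrix.one_mulVec] at this
      exact this
    simp only [hgradB, mul_add, Finset.sum_add_distrib, hδ, add_sub_cancel_right]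
    simp only [hcomm _ _ β, Finset.mul_sum]
    rw [Finset.sum_comm]
    exact Finset.sum_congr rfl fun _ _ => Finset.sum_congr rfl fun _ _ => by ring
  have htension : ∀ ν α, dirDeriv (e ν) (fun x => ∑ μ, b₀ μ x * dirDeriv (e μ) (B α) x) p =
      ∑ μ, dirDeriv (e ν) (b₀ μ) p * dirDeriv (e μ) (B α) p +
        ∑ μ, b₀ μ p * dirDeriv (e ν) (dirDeriv (e μ) (B α)) p := fun ν α => by
    rw [dirDeriv_sum fun μ _ => (hb₀' μ).fun_mul (hdB μ α)]
    simp only [dirDeriv_mul (hb₀' _) (hdB _ _), Finset.sum_add_distrib]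
  have hsecond : ∑ ν, ∑ α, (frameJac e h p)⁻¹ ν α *
        ∑ μ, b₀ μ p * dirDeriv (e ν) (dirDeriv (e μ) (B α)) p =
      ∑ β, ∑ ν, ∑ α, (∑ μ, b₀ μ p * ∑ γ, (frameJac e h p)⁻¹ ν γ *
        dirDeriv (e μ) (dirDeriv (e β) (h γ)) p) * (frameJac e h p)⁻¹ β α *
          dirDeriv (e ν) (B α) p := by
    have hdiv' := fun μ =>
      sum_frameJac_inv_mul_dirDeriv_dirDeriv hU hh hdet hBC hdiv hp (e μ)
    simp only [dirDeriv_frameJac_inv hU hh hdet hp] at hdiv'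
    trans ∑ μ, b₀ μ p * ∑ ν, ∑ α, (frameJac e h p)⁻¹ ν α *
        dirDeriv (e ν) (dirDeriv (e μ) (B α)) p
    · simp only [Fin.sum_univ_three]; ring
    · rw [Finset.sum_congr rfl fun μ _ => by rw [hdiv' μ]]
      simp only [Fin.sum_univ_three]; ring
  simp only [htension, mul_add, Finset.sum_add_distrib, hsecond, ← hstretch]
  simp only [Fin.sum_univ_three]
  ring

/-- The pressure equation for a deformation `h`, with derivatives along a spatial frame `e` and a
time direction `τ`. -/
lemma sum_dirDeriv_dirDeriv_pressure (hU : IsOpen U) (hh : ∀ α, ContDiffOn ℝ 3 (h α) U)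
    (hdet : ∀ p ∈ U, (frameJac e h p).det = 1) (τ : E)
    {b₀ B : Fin 3 → E → ℝ} (hb₀ : ∀ μ, ContDiffOn ℝ 2 (b₀ μ) U)
    (hB : ∀ α, ∀ p ∈ U, B α p = ∑ μ, dirDeriv (e μ) (h α) p * b₀ μ p)
    {q : E → ℝ} (hq : ContDiffOn ℝ 2 q U)
    (hmom : ∀ p ∈ U, ∀ α, dirDeriv τ (dirDeriv τ (h α)) p =
      ∑ μ, b₀ μ p * dirDeriv (e μ) (B α) p -
        ∑ μ, (frameJac e h p)⁻¹ μ α * dirDeriv (e μ) q p)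
    (hdivv : ∀ p ∈ U, ∑ ν, ∑ α, (frameJac e h p)⁻¹ ν α *
      dirDeriv (e ν) (dirDeriv τ (h α)) p = 0)
    (hdivB : ∀ p ∈ U, ∑ ν, ∑ α, (frameJac e h p)⁻¹ ν α * dirDeriv (e ν) (B α) p = 0)
    {p : E} (hp : p ∈ U) :
    ∑ μ, dirDeriv (e μ) (dirDeriv (e μ) q) p =
      (∑ ν, ∑ α, dirDeriv τ (fun x => (frameJac e h x)⁻¹ ν α) p *
          dirDeriv (e ν) (dirDeriv τ (h α)) p)
        + (∑ ν, ∑ μ, dirDeriv (e ν) (fun x => ((if μ = ν then (1 : ℝ) else 0) -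
            ∑ α, (frameJac e h x)⁻¹ μ α * (frameJac e h x)⁻¹ ν α) * dirDeriv (e μ) q x) p)
        + (∑ ν, ∑ α, ∑ μ, (frameJac e h p)⁻¹ ν α * dirDeriv (e ν) (b₀ μ) p *
            dirDeriv (e μ) (B α) p)
        + (∑ β, ∑ γ, ∑ ν, ∑ α, dirDeriv (e β) (B γ) p * (frameJac e h p)⁻¹ ν γ *
            (frameJac e h p)⁻¹ β α * dirDeriv (e ν) (B α) p)
        - ∑ β, ∑ μ, ∑ α, dirDeriv (e β) (b₀ μ) p * (frameJac e h p)⁻¹ β α *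
            dirDeriv (e μ) (B α) p := by
  have hA : ∀ ν α, DifferentiableAt ℝ (fun x => (frameJac e h x)⁻¹ ν α) p := fun ν α =>
    (contDiffOn_frameJac_inv hU hh hdet ν α).differentiableAt_of_isOpen hU (by norm_num) hp
  have hdq : ∀ μ, DifferentiableAt ℝ (dirDeriv (e μ) q) p := fun μ =>
    (hq.dirDeriv hU (m := 1) (by norm_num) _).differentiableAt_of_isOpen hU (by norm_num) hp
  have hdh : ∀ α v, ContDiffOn ℝ 2 (dirDeriv v (h α)) U := fun α v =>
    (hh α).dirDeriv hU (by norm_num) _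
  have hBC : ∀ α, ContDiffOn ℝ 2 (B α) U := fun α =>
    (ContDiffOn.sum fun μ _ => (hdh α (e μ)).mul (hb₀ μ)).congr (hB α)
  have hforce : ∀ α, DifferentiableAt ℝ
      (fun x => ∑ μ, (frameJac e h x)⁻¹ μ α * dirDeriv (e μ) q x) p := fun α =>
    DifferentiableAt.fun_sum fun μ _ => (hA μ α).fun_mul (hdq μ)
  have htension : ∀ α, DifferentiableAt ℝ (fun x => ∑ μ, b₀ μ x * dirDeriv (e μ) (B α) x) p :=
    fun α => DifferentiableAt.fun_sum fun μ _ =>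
      ((hb₀ μ).differentiableAt_of_isOpen hU (by norm_num) hp).fun_mul
        (((hBC α).dirDeriv hU (m := 1) (by norm_num) _).differentiableAt_of_isOpen hU
          (by norm_num) hp)
  have hgradForce : ∀ ν α,
      dirDeriv (e ν) (fun x => ∑ μ, (frameJac e h x)⁻¹ μ α * dirDeriv (e μ) q x) p =
        dirDeriv (e ν) (fun x => ∑ μ, b₀ μ x * dirDeriv (e μ) (B α) x) p -
          dirDeriv (e ν) (dirDeriv τ (dirDeriv τ (h α))) p := fun ν α => by
    rw [← dirDeriv_sub (htension α) (((hdh α τ).dirDeriv hU (m := 1) (by norm_num)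
      τ).differentiableAt_of_isOpen hU (by norm_num) hp)]
    exact dirDeriv_congr hU (fun x hx => by simp [hmom x hx α]) hp
  have hdivForce : ∑ ν, dirDeriv (e ν) (fun x => ∑ α, (frameJac e h x)⁻¹ ν α *
        ∑ μ, (frameJac e h x)⁻¹ μ α * dirDeriv (e μ) q x) p =
      ∑ ν, ∑ α, (frameJac e h p)⁻¹ ν α *
        dirDeriv (e ν) (fun x => ∑ μ, (frameJac e h x)⁻¹ μ α * dirDeriv (e μ) q x) p := by
    simp_rw [dirDeriv_sum fun α _ => (hA _ α).fun_mul (hforce α),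
      dirDeriv_mul (hA _ _) (hforce _), Finset.sum_add_distrib]
    rw [Finset.sum_comm]
    simp_rw [← Finset.sum_mul, sum_dirDeriv_frameJac_inv hU hh hdet hp]
    simp
  have hsplit : ∑ ν, ∑ μ, dirDeriv (e ν) (fun x => ((if μ = ν then (1 : ℝ) else 0) -
        ∑ α, (frameJac e h x)⁻¹ μ α * (frameJac e h x)⁻¹ ν α) * dirDeriv (e μ) q x) p =
      ∑ ν, dirDeriv (e ν) (dirDeriv (e ν) q) p -
        ∑ ν, dirDeriv (e ν) (fun x => ∑ α, (frameJac e h x)⁻¹ ν α *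
          ∑ μ, (frameJac e h x)⁻¹ μ α * dirDeriv (e μ) q x) p := by
    rw [← Finset.sum_sub_distrib]
    refine Finset.sum_congr rfl fun ν _ => ?_
    rw [← dirDeriv_sub (hdq ν) (DifferentiableAt.fun_sum fun α _ =>
      (hA ν α).fun_mul (hforce α)), ← dirDeriv_sum fun μ _ => ((differentiableAt_const _).fun_sub
        (DifferentiableAt.fun_sum fun α _ => (hA μ α).fun_mul (hA ν α))).fun_mul (hdq μ)]
    congr 1
    funext x
    simp only [sub_mul, Finset.sum_sub_distrib, ite_mul, one_mul, zero_mul,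
      Finset.sum_ite_eq', Finset.mem_univ, if_true, Finset.sum_mul, Finset.mul_sum]
    rw [Finset.sum_comm]
    congr 1
    exact Finset.sum_congr rfl fun _ _ => Finset.sum_congr rfl fun _ _ => by ring
  have haccel := sum_frameJac_inv_mul_dirDeriv_dirDeriv hU hh hdet
    (V := fun α => dirDeriv τ (h α)) (fun α => hdh α τ) hdivv hp τ
  have hmag := sum_frameJac_inv_mul_dirDeriv_tension hU hh hdet hb₀ hB hdivB hp
  simp only [hgradForce, mul_sub, Finset.sum_sub_distrib, haccel, hmag] at hdivForce
  rw [hsplit, hdivForce]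
  ring

end Deformation

section SpaceTime

variable {I : Set ℝ} {Ω : Set (Fin 3 → ℝ)}

lemma pd_eq_dirDeriv (hΩ : IsOpen Ω) {F : (Fin 3 → ℝ) → ℝ} {G : ℝ × (Fin 3 → ℝ) → ℝ} {t : ℝ}
    {y : Fin 3 → ℝ} (hy : y ∈ Ω) (hFG : ∀ z ∈ Ω, F z = G (t, z))
    (hG : DifferentiableAt ℝ G (t, y)) (μ : Fin 3) :
    pd F μ y = dirDeriv (0, Pi.single μ 1) G (t, y) := by
  have hF : F =ᶠ[nhds y] fun z => G (t, z) := Filter.eventuallyEq_of_mem (hΩ.mem_nhds hy) hFG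
  have : HasFDerivAt (fun z => G (t, z)) _ y :=
    hG.hasFDerivAt.comp y (hasFDerivAt_prodMk_right t y)
  rw [pd, hF.fderiv_eq, this.fderiv]
  rfl

lemma deriv_eq_dirDeriv (hI : IsOpen I) {F : ℝ → ℝ} {G : ℝ × (Fin 3 → ℝ) → ℝ} {t : ℝ}
    {y : Fin 3 → ℝ} (ht : t ∈ I) (hFG : ∀ s ∈ I, F s = G (s, y))
    (hG : DifferentiableAt ℝ G (t, y)) :
    deriv F t = dirDeriv (1, 0) G (t, y) := by
  have hF : F =ᶠ[nhds t] fun s => G (s, y) := Filter.eventuallyEq_of_mem (hI.mem_nhds ht) hFG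
  have : HasFDerivAt (fun s => G (s, y)) _ t :=
    HasFDerivAt.comp (f := fun s : ℝ => (s, y)) t hG.hasFDerivAt (hasFDerivAt_prodMk_left t y)
  rw [hF.deriv_eq, ← fderiv_apply_one_eq_deriv, this.fderiv]
  rfl

end SpaceTime

/-- **Interior elliptic equation for the total pressure** (equation (3.2)).
With `v := ∂_tη`, `a := (D_yη)⁻¹`, `b := D_yη·b₀`, the momentum equation, and the
Eulerian divergence-free conditions for `v` and `b`, the total pressure satisfies
`ΔQ = ∂_t a^{να}∂_ν v_α + ∂_ν((δ^{μν} − a^{μα}a^{να})∂_μQ) + a^{να}∂_ν b₀^μ ∂_μ b_α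
      + ∂_β b_γ a^{νγ} a^{βα} ∂_ν b_α − ∂_β b₀^μ a^{βα} ∂_μ b_α`. -/
theorem pressure_interior_equation
    (I : Set ℝ) (hIopen : IsOpen I) (hIconn : I.OrdConnected)
    (Ω : Set (Fin 3 → ℝ)) (hΩ : IsOpen Ω)
    (η : ℝ → (Fin 3 → ℝ) → (Fin 3 → ℝ))
    (hη : ContDiffOn ℝ 3 (Function.uncurry η) (I ×ˢ Ω))
    (hdet : ∀ t ∈ I, ∀ y ∈ Ω, (jac (η t) y).det = 1)
    (b₀ : (Fin 3 → ℝ) → (Fin 3 → ℝ)) (hb₀ : ContDiffOn ℝ 2 b₀ Ω)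
    (b : ℝ → (Fin 3 → ℝ) → (Fin 3 → ℝ))
    (hbdef : ∀ (t : ℝ) (y : Fin 3 → ℝ), b t y = (jac (η t) y).mulVec (b₀ y))
    (Q : ℝ → (Fin 3 → ℝ) → ℝ)
    (hQ : ContDiffOn ℝ 2 (Function.uncurry Q) (I ×ˢ Ω))
    -- (i) momentum equation ∂_t v_α = b₀^μ ∂_μ b_α − a^{μα} ∂_μ Q
    (hmom : ∀ t ∈ I, ∀ y ∈ Ω, ∀ α : Fin 3,
      deriv (fun s => tderiv η s y α) t
        = ∑ μ : Fin 3, b₀ y μ * pd (fun z => b t z α) μ y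
          - ∑ μ : Fin 3, (jac (η t) y)⁻¹ μ α * pd (fun z => Q t z) μ y)
    -- (ii) incompressibility of v
    (hdivv : ∀ t ∈ I, ∀ y ∈ Ω,
      ∑ μ : Fin 3, ∑ α : Fin 3,
        (jac (η t) y)⁻¹ μ α * pd (fun z => tderiv η t z α) μ y = 0)
    -- (iii) divergence-free condition for b
    (hdivb : ∀ t ∈ I, ∀ y ∈ Ω,
      ∑ μ : Fin 3, ∑ α : Fin 3,
        (jac (η t) y)⁻¹ μ α * pd (fun z => b t z α) μ y = 0) :
    ∀ t ∈ I, ∀ y ∈ Ω,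
      ∑ μ : Fin 3, pd (fun z => pd (fun w => Q t w) μ z) μ y
        = (∑ ν : Fin 3, ∑ α : Fin 3,
            deriv (fun s => (jac (η s) y)⁻¹ ν α) t * pd (fun z => tderiv η t z α) ν y)
          + (∑ ν : Fin 3, ∑ μ : Fin 3,
              pd (fun z =>
                  ((if μ = ν then (1:ℝ) else 0)
                      - ∑ α : Fin 3, (jac (η t) z)⁻¹ μ α * (jac (η t) z)⁻¹ ν α)
                    * pd (fun w => Q t w) μ z) ν y)
          + (∑ ν : Fin 3, ∑ α : Fin 3, ∑ μ : Fin 3,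
              (jac (η t) y)⁻¹ ν α * pd (fun z => b₀ z μ) ν y * pd (fun z => b t z α) μ y)
          + (∑ β : Fin 3, ∑ γ : Fin 3, ∑ ν : Fin 3, ∑ α : Fin 3,
              pd (fun z => b t z γ) β y * (jac (η t) y)⁻¹ ν γ * (jac (η t) y)⁻¹ β α
                * pd (fun z => b t z α) ν y)
          - (∑ β : Fin 3, ∑ μ : Fin 3, ∑ α : Fin 3,
              pd (fun z => b₀ z μ) β y * (jac (η t) y)⁻¹ β α * pd (fun z => b t z α) μ y) := by
  let U : Set (ℝ × (Fin 3 → ℝ)) := I ×ˢ Ω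
  have hU : IsOpen U := hIopen.prod hΩ
  let e : Fin 3 → ℝ × (Fin 3 → ℝ) := fun μ => (0, Pi.single μ 1)
  let τ : ℝ × (Fin 3 → ℝ) := (1, 0)
  let h : Fin 3 → ℝ × (Fin 3 → ℝ) → ℝ := fun α p => η p.1 p.2 α
  let c : Fin 3 → ℝ × (Fin 3 → ℝ) → ℝ := fun μ p => b₀ p.2 μ
  let B : Fin 3 → ℝ × (Fin 3 → ℝ) → ℝ := fun α p => b p.1 p.2 α
  let q : ℝ × (Fin 3 → ℝ) → ℝ := Function.uncurry Q
  have hh : ∀ α, ContDiffOn ℝ 3 (h α) U := contDiffOn_pi.1 hη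
  have hc : ∀ μ, ContDiffOn ℝ 2 (c μ) U := contDiffOn_pi.1
    (hb₀.comp contDiffOn_snd fun p hp => hp.2)
  have hdh : ∀ α v, ContDiffOn ℝ 2 (dirDeriv v (h α)) U := fun α v =>
    (hh α).dirDeriv hU (by norm_num) _
  have hdiff : ∀ {f : ℝ × (Fin 3 → ℝ) → ℝ}, ContDiffOn ℝ 2 f U → ∀ t ∈ I, ∀ y ∈ Ω,
      DifferentiableAt ℝ f (t, y) := fun hf t ht y hy =>
    hf.differentiableAt_of_isOpen hU (by norm_num) ⟨ht, hy⟩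
  have hJ : ∀ t ∈ I, ∀ y ∈ Ω, jac (η t) y = frameJac e h (t, y) := by
    intro t ht y hy
    ext α μ
    exact pd_eq_dirDeriv hΩ hy (fun _ _ => rfl) (hdiff ((hh α).of_le (by norm_num)) t ht y hy) μ
  have hdet' : ∀ p ∈ U, (frameJac e h p).det = 1 := fun p hp => by
    rw [← hdet p.1 hp.1 p.2 hp.2, hJ p.1 hp.1 p.2 hp.2]
  have hA : ∀ ν α, ContDiffOn ℝ 2 (fun p => (frameJac e h p)⁻¹ ν α) U :=
    contDiffOn_frameJac_inv hU hh hdet'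
  have hB : ∀ α, ∀ p ∈ U, B α p = ∑ μ, dirDeriv (e μ) (h α) p * c μ p := fun α p hp => by
    simp only [B, hbdef, hJ p.1 hp.1 p.2 hp.2]
    rfl
  have hBC : ∀ α, ContDiffOn ℝ 2 (B α) U := fun α =>
    (ContDiffOn.sum fun μ _ => (hdh α (e μ)).mul (hc μ)).congr (hB α)
  have hv : ∀ t ∈ I, ∀ y ∈ Ω, ∀ α, tderiv η t y α = dirDeriv τ (h α) (t, y) := by
    intro t ht y hy α
    have hdη : ∀ α, DifferentiableAt ℝ (fun s => η s y α) t := fun α =>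
      DifferentiableAt.comp (f := fun s : ℝ => (s, y)) t
        (hdiff ((hh α).of_le (by norm_num)) t ht y hy) (by fun_prop)
    rw [tderiv, deriv_pi hdη]
    exact deriv_eq_dirDeriv hIopen ht (fun _ _ => rfl)
      (hdiff ((hh α).of_le (by norm_num)) t ht y hy)
  have hpdB : ∀ t ∈ I, ∀ y ∈ Ω, ∀ α μ, pd (fun z => b t z α) μ y =
      dirDeriv (e μ) (B α) (t, y) := fun t ht y hy α μ =>
    pd_eq_dirDeriv hΩ hy (fun _ _ => rfl) (hdiff (hBC α) t ht y hy) μ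
  have hpdc : ∀ t ∈ I, ∀ y ∈ Ω, ∀ μ ν, pd (fun z => b₀ z μ) ν y =
      dirDeriv (e ν) (c μ) (t, y) := fun t ht y hy μ ν =>
    pd_eq_dirDeriv hΩ hy (fun _ _ => rfl) (hdiff (hc μ) t ht y hy) ν
  have hpdQ : ∀ t ∈ I, ∀ y ∈ Ω, ∀ μ, pd (fun z => Q t z) μ y =
      dirDeriv (e μ) q (t, y) := fun t ht y hy μ =>
    pd_eq_dirDeriv hΩ hy (fun _ _ => rfl) (hdiff hQ t ht y hy) μ
  have hpdv : ∀ t ∈ I, ∀ y ∈ Ω, ∀ α ν, pd (fun z => tderiv η t z α) ν y =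
      dirDeriv (e ν) (dirDeriv τ (h α)) (t, y) := fun t ht y hy α ν =>
    pd_eq_dirDeriv hΩ hy (fun z hz => hv t ht z hz α) (hdiff (hdh α τ) t ht y hy) ν
  have hdq : ∀ t ∈ I, ∀ y ∈ Ω, ∀ μ, DifferentiableAt ℝ (dirDeriv (e μ) q) (t, y) :=
    fun t ht y hy μ => (hQ.dirDeriv hU (m := 1) (by norm_num) _).differentiableAt_of_isOpen hU
      (by norm_num) ⟨ht, hy⟩
  intro t ht y hy
  have key := sum_dirDeriv_dirDeriv_pressure (p := (t, y)) hU hh hdet' τ hc hB (q := q) hQ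
    (by
      rintro ⟨s, z⟩ ⟨hs, hz⟩ α
      have := hmom s hs z hz α
      simp only [hJ s hs z hz, hpdB s hs z hz, hpdQ s hs z hz] at this
      rw [← this]
      exact (deriv_eq_dirDeriv hIopen hs (fun r hr => hv r hr z hz α)
        (hdiff (hdh α τ) s hs z hz)).symm)
    (by
      rintro ⟨s, z⟩ ⟨hs, hz⟩
      have := hdivv s hs z hz
      simpa only [hJ s hs z hz, hpdv s hs z hz] using this)
    (by
      rintro ⟨s, z⟩ ⟨hs, hz⟩
      have := hdivb s hs z hz
      simpa only [hJ s hs z hz, hpdB s hs z hz] using this)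
    ⟨ht, hy⟩
  have hlap : ∀ μ, pd (fun z => pd (fun w => Q t w) μ z) μ y =
      dirDeriv (e μ) (dirDeriv (e μ) q) (t, y) := fun μ =>
    pd_eq_dirDeriv hΩ hy (fun z hz => hpdQ t ht z hz μ) (hdq t ht y hy μ) μ
  have hdtA : ∀ ν α, deriv (fun s => (jac (η s) y)⁻¹ ν α) t =
      dirDeriv τ (fun p => (frameJac e h p)⁻¹ ν α) (t, y) := fun ν α =>
    deriv_eq_dirDeriv hIopen ht (fun s hs => by rw [hJ s hs y hy]) (hdiff (hA ν α) t ht y hy)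
  have hcorr : ∀ ν μ, pd (fun z => ((if μ = ν then (1 : ℝ) else 0) -
        ∑ α : Fin 3, (jac (η t) z)⁻¹ μ α * (jac (η t) z)⁻¹ ν α) * pd (fun w => Q t w) μ z) ν y =
      dirDeriv (e ν) (fun x => ((if μ = ν then (1 : ℝ) else 0) -
        ∑ α, (frameJac e h x)⁻¹ μ α * (frameJac e h x)⁻¹ ν α) * dirDeriv (e μ) q x) (t, y) :=
    fun ν μ => pd_eq_dirDeriv hΩ hy (fun z hz => by rw [hJ t ht z hz, hpdQ t ht z hz μ])
      (((differentiableAt_const _).fun_sub (DifferentiableAt.fun_sum fun α _ =>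
        (hdiff (hA μ α) t ht y hy).fun_mul (hdiff (hA ν α) t ht y hy))).fun_mul
          (hdq t ht y hy μ)) ν
  simp only [hlap, hdtA, hcorr, hpdv t ht y hy, hpdB t ht y hy, hpdc t ht y hy, hJ t ht y hy]
  exact key
end

section
/- Time-derivative identity for the mean-curvature operator (the identity used in Section 6, stated in Section 1.3): Let U ⊆ ℝ² be open, I an interval, and η : I × U → ℝ³ be C³ in all variables. Set v := ∂_tη, g_ij := ∂_iη·∂_jη (i,j ∈ {1,2}), assume det(g_ij) > 0 everywhere, let g^{ij} be the entries of (g_ij)^{-1}, √g := √(det g), and define the tangential projection Π^α_λ := δ^α_λ − Σ_{k,l} g^{kl} ∂_kη^α ∂_lη_λ. Then for every α ∈ {1,2,3}, at every point: ∂_t[ Σ_{i,j} ∂_i(√g g^{ij} ∂_jη^α) ] = Σ_i ∂_i[ Σ_{j,λ} √g g^{ij} Π^α_λ ∂_j v^λ + Σ_{j,k,l,λ} √g (g^{ij} g^{kl} − g^{lj} g^{ik}) ∂_jη^α ∂_kη_λ ∂_l v^λ ]. -/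
open scoped BigOperators

/-- Partial derivative in the `i`-th coordinate direction of a scalar function on `ℝ²`. -/
noncomputable def pd2 (f : (Fin 2 → ℝ) → ℝ) (i : Fin 2) (y : Fin 2 → ℝ) : ℝ :=
  fderiv ℝ f y (Pi.single i 1)

/-- The induced metric `g_ij := ∂_iη·∂_jη` of an immersion `η : ℝ² → ℝ³`. -/
noncomputable def metric (η : (Fin 2 → ℝ) → (Fin 3 → ℝ)) (y : Fin 2 → ℝ) :
    Matrix (Fin 2) (Fin 2) ℝ :=
  Matrix.of fun i j => ∑ α : Fin 3,
    pd2 (fun z => η z α) i y * pd2 (fun z => η z α) j y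

/-- The velocity `v := ∂_tη` of a moving surface. -/
noncomputable def tderiv2 (η : ℝ → (Fin 2 → ℝ) → (Fin 3 → ℝ)) (t : ℝ) (y : Fin 2 → ℝ) :
    Fin 3 → ℝ :=
  deriv (fun s => η s y) t

/-- The tangential projection `Π^α_λ := δ^α_λ − Σ_{k,l} g^{kl} ∂_kη^α ∂_lη_λ`. -/
noncomputable def tanProj (η : (Fin 2 → ℝ) → (Fin 3 → ℝ)) (y : Fin 2 → ℝ)
    (α lam : Fin 3) : ℝ :=
  (if α = lam then 1 else 0)
    - ∑ k : Fin 2, ∑ l : Fin 2,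
        (metric η y)⁻¹ k l * pd2 (fun z => η z α) k y * pd2 (fun z => η z lam) l y

open Filter Topology
open scoped ContDiff

section PartialDerivatives

variable {E : Type*} [NormedAddCommGroup E] [NormedSpace ℝ E]

theorem fderiv_slice_apply {f : ℝ → E → ℝ} {s : ℝ} {z : E}
    (hf : DifferentiableAt ℝ (Function.uncurry f) (s, z)) (e : E) :
    fderiv ℝ (f s) z e = fderiv ℝ (Function.uncurry f) (s, z) (0, e) := by
  have h : HasFDerivAt (fun w : E => (s, w)) (ContinuousLinearMap.inr ℝ ℝ E) z :=
    (hasFDerivAt_const s z).prodMk (hasFDerivAt_id z)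
  have h' : HasFDerivAt (f s) _ z := hf.hasFDerivAt.comp z h
  rw [h'.fderiv]
  simp

theorem deriv_slice {f : ℝ → E → ℝ} {s : ℝ} {z : E}
    (hf : DifferentiableAt ℝ (Function.uncurry f) (s, z)) :
    deriv (fun r => f r z) s = fderiv ℝ (Function.uncurry f) (s, z) (1, 0) := by
  have h : HasDerivAt (fun r : ℝ => (r, z)) ((1 : ℝ), (0 : E)) s :=
    (hasDerivAt_id s).prodMk (hasDerivAt_const s z)
  exact (hf.hasFDerivAt.comp_hasDerivAt s h).deriv

/-- Time and space derivatives of a `C²` function commute. -/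
theorem hasDerivAt_fderiv_slice {f : ℝ → E → ℝ} {t : ℝ} {y : E}
    (hf : ContDiffAt ℝ 2 (Function.uncurry f) (t, y)) (e : E) :
    HasDerivAt (fun s => fderiv ℝ (f s) y e)
      (fderiv ℝ (fun z => deriv (fun s => f s z) t) y e) t := by
  have hd : ∀ᶠ p in 𝓝 (t, y), DifferentiableAt ℝ (Function.uncurry f) p :=
    (hf.eventually (by simp)).mono fun p hp => hp.differentiableAt (by simp)
  have hD : HasFDerivAt (fderiv ℝ (Function.uncurry f))
      (fderiv ℝ (fderiv ℝ (Function.uncurry f)) (t, y)) (t, y) :=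
    ((hf.fderiv_right (m := 1) (by norm_num)).differentiableAt (by simp)).hasFDerivAt
  have ht : HasDerivAt (fun r : ℝ => (r, y)) ((1 : ℝ), (0 : E)) t :=
    (hasDerivAt_id t).prodMk (hasDerivAt_const t y)
  have hy : HasFDerivAt (fun w : E => (t, w)) (ContinuousLinearMap.inr ℝ ℝ E) y :=
    (hasFDerivAt_const t y).prodMk (hasFDerivAt_id y)
  have hDv : ∀ v, HasFDerivAt (fun p => fderiv ℝ (Function.uncurry f) p v)
      ((fderiv ℝ (fderiv ℝ (Function.uncurry f)) (t, y)).flip v) (t, y) := fun v =>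
    ((ContinuousLinearMap.apply ℝ ℝ v).hasFDerivAt.comp (t, y) hD).congr_fderiv (by ext <;> rfl)
  have h₁ := (hDv (0, e)).comp_hasDerivAt t ht
  replace h₁ : HasDerivAt (fun s => fderiv ℝ (f s) y e) _ t := h₁.congr_of_eventuallyEq
    ((ht.continuousAt.eventually hd).mono fun s hs => fderiv_slice_apply hs e)
  have h₂ : HasFDerivAt (fun z => deriv (fun s => f s z) t) _ y :=
    ((hDv (1, 0)).comp y hy).congr_of_eventuallyEq
      ((hy.continuousAt.eventually hd).mono fun z hz => deriv_slice hz)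
  have hsymm := (hf.isSymmSndFDerivAt (by simp)).eq (1, 0) (0, e)
  rw [h₂.fderiv]
  simpa [hsymm] using h₁

theorem ContDiffAt.fderiv_slice_apply {f : ℝ → E → ℝ} {t : ℝ} {y : E} {m n : WithTop ℕ∞}
    (hf : ContDiffAt ℝ n (Function.uncurry f) (t, y)) (hmn : m + 1 ≤ n) (hn : n ≠ ∞) (e : E) :
    ContDiffAt ℝ m (fun p : ℝ × E => fderiv ℝ (f p.1) p.2 e) (t, y) := by
  have h : ContDiffAt ℝ m
      (fun p : ℝ × E => fderiv ℝ (Function.uncurry f) p ((0 : ℝ), e)) (t, y) :=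
    (hf.fderiv_right hmn).clm_apply contDiffAt_const
  refine h.congr_of_eventuallyEq ?_
  filter_upwards [hf.eventually hn] with p hp
  exact _root_.fderiv_slice_apply (hp.differentiableAt (by rintro rfl; simp at hmn)) e

end PartialDerivatives

/-- The weights `√g g^{ij}` are the adjugate entries divided by `√g`. -/
theorem sqrt_det_mul_inv_apply {n : Type*} [Fintype n] [DecidableEq n]
    (M : Matrix n n ℝ) (i j : n) :
    √M.det * M⁻¹ i j = (√M.det)⁻¹ * M.adjugate i j := by
  rw [Matrix.inv_def, Ring.inverse_eq_inv', Matrix.smul_apply, smul_eq_mul, ← mul_assoc,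
    ← div_eq_mul_inv, Real.sqrt_div_self', one_div]

/-- The Gram matrix of the two columns of `p`. -/
def colGram (p : Fin 3 → Fin 2 → ℝ) : Matrix (Fin 2) (Fin 2) ℝ :=
  Matrix.of fun i j => ∑ a, p a i * p a j

theorem colGram_det (p : Fin 3 → Fin 2 → ℝ) :
    (colGram p).det = colGram p 0 0 * colGram p 1 1 - colGram p 0 1 ^ 2 := by
  rw [Matrix.det_fin_two, sq]
  simp only [colGram, Matrix.of_apply, mul_comm]

theorem colGram_comm (p : Fin 3 → Fin 2 → ℝ) (i j : Fin 2) :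
    colGram p i j = colGram p j i := by
  simp only [colGram, Matrix.of_apply, mul_comm]

/-- The flux `∑ⱼ √g g^{ij} pⱼ^α` of which the mean-curvature operator is the divergence. -/
noncomputable def flux (p : Fin 3 → Fin 2 → ℝ) (i : Fin 2) (α : Fin 3) : ℝ :=
  ∑ j, √(colGram p).det * (colGram p)⁻¹ i j * p α j

theorem contDiffAt_colGram {X : Type*} [NormedAddCommGroup X] [NormedSpace ℝ X]
    {p : X → Fin 3 → Fin 2 → ℝ} {x : X} {n : WithTop ℕ∞}
    (hp : ∀ a j, ContDiffAt ℝ n (fun x => p x a j) x) (i j : Fin 2) :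
    ContDiffAt ℝ n (fun x => colGram (p x) i j) x := by
  simp only [colGram, Matrix.of_apply]
  exact ContDiffAt.sum fun a _ => (hp a i).mul (hp a j)

theorem contDiffAt_flux_term {X : Type*} [NormedAddCommGroup X] [NormedSpace ℝ X]
    {p : X → Fin 3 → Fin 2 → ℝ} {x : X} {n : WithTop ℕ∞}
    (hp : ∀ a j, ContDiffAt ℝ n (fun x => p x a j) x) (hpos : 0 < (colGram (p x)).det)
    (i j : Fin 2) (α : Fin 3) :
    ContDiffAt ℝ n
      (fun x => √(colGram (p x)).det * (colGram (p x))⁻¹ i j * p x α j) x := by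
  have hG := contDiffAt_colGram hp
  have hdet : ContDiffAt ℝ n (fun x => (colGram (p x)).det) x := by
    simp only [Matrix.det_fin_two]
    exact ((hG 0 0).mul (hG 1 1)).sub ((hG 0 1).mul (hG 1 0))
  have hadj : ContDiffAt ℝ n (fun x => (colGram (p x)).adjugate i j) x := by
    fin_cases i <;> fin_cases j <;> simp [Matrix.adjugate_fin_two, hG, ContDiffAt.neg]
  simp only [sqrt_det_mul_inv_apply]
  exact (((hdet.sqrt hpos.ne').inv (Real.sqrt_pos.2 hpos).ne').mul hadj).mul (hp α j)

/-- First variation of the flux. -/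
theorem hasDerivAt_flux {p : ℝ → Fin 3 → Fin 2 → ℝ} {q : Fin 3 → Fin 2 → ℝ} {t : ℝ}
    (hp : ∀ a j, HasDerivAt (fun s => p s a j) (q a j) t) (hpos : 0 < (colGram (p t)).det)
    (i : Fin 2) (α : Fin 3) :
    HasDerivAt (fun s => flux (p s) i α)
      ((∑ j, ∑ lam, √(colGram (p t)).det * (colGram (p t))⁻¹ i j
          * ((if α = lam then 1 else 0)
            - ∑ k, ∑ l, (colGram (p t))⁻¹ k l * p t α k * p t lam l) * q lam j)
        + ∑ j, ∑ k, ∑ l, ∑ lam, √(colGram (p t)).det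
          * ((colGram (p t))⁻¹ i j * (colGram (p t))⁻¹ k l
            - (colGram (p t))⁻¹ l j * (colGram (p t))⁻¹ i k)
          * p t α j * p t lam k * q lam l) t := by
  set r := √(colGram (p t)).det with hr
  set S : Fin 2 → Fin 2 → ℝ := fun k l => ∑ a, p t a k * q a l with hS
  have hG : ∀ k l, HasDerivAt (fun s => colGram (p s) k l) (S l k + S k l) t := fun k l => by
    simp only [colGram, Matrix.of_apply, hS, ← Finset.sum_add_distrib]
    exact HasDerivAt.fun_sum fun a _ => by
      simpa only [mul_comm] using (hp a k).fun_mul (hp a l)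
  have hdet : HasDerivAt (fun s => (colGram (p s)).det) _ t :=
    (((hG 0 0).mul (hG 1 1)).sub ((hG 0 1).pow 2)).congr_of_eventuallyEq
      (Eventually.of_forall fun s => colGram_det (p s))
  have hr0 : r ≠ 0 := (Real.sqrt_pos.2 hpos).ne'
  have hr2 : r ^ 2 = colGram (p t) 0 0 * colGram (p t) 1 1 - colGram (p t) 0 1 ^ 2 := by
    rw [Real.sq_sqrt hpos.le, colGram_det]
  have hinv : ∀ k l, (colGram (p t))⁻¹ k l = (colGram (p t)).adjugate k l / r ^ 2 := fun k l => by
    rw [Real.sq_sqrt hpos.le, Matrix.inv_def, Ring.inverse_eq_inv', Matrix.smul_apply,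
      smul_eq_mul, div_eq_inv_mul]
  have hrinv := (hdet.sqrt hpos.ne').inv hr0
  have htan : ∀ (h : Matrix (Fin 2) (Fin 2) ℝ) (c : ℝ) (j : Fin 2),
      ∑ lam, c * ((if α = lam then 1 else 0) - ∑ k, ∑ l, h k l * p t α k * p t lam l) * q lam j
        = c * (q α j - ∑ k, ∑ l, h k l * p t α k * S l j) := fun h c j => by
    have hδ : q α j = ∑ lam, (if α = lam then 1 else 0) * q lam j := by simp
    rw [hδ]
    simp only [hS, Fin.sum_univ_two, Fin.sum_univ_three]
    ring
  have hcon : ∀ (c : ℝ) (k l : Fin 2),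
      ∑ lam, c * p t lam k * q lam l = c * S k l := fun c k l => by
    simp only [hS, Finset.mul_sum, mul_assoc]
  simp only [htan, hcon]
  simp only [hinv, flux, sqrt_det_mul_inv_apply, Fin.sum_univ_two,
    Matrix.adjugate_fin_two]
  fin_cases i
  · refine (((hrinv.mul (hG 1 1)).mul (hp α 0)).add
      ((hrinv.mul (hG 0 1).neg).mul (hp α 1))).congr_deriv ?_
    simp [colGram_comm (p t) 1 0, ← hr]
    field_simp
    linear_combination 2 * (2 * S 1 1 * p t α 0 - (S 0 1 + S 1 0) * p t α 1) * hr2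
  · refine (((hrinv.mul (hG 1 0).neg).mul (hp α 0)).add
      ((hrinv.mul (hG 0 0)).mul (hp α 1))).congr_deriv ?_
    simp [colGram_comm (p t) 1 0, ← hr]
    field_simp
    linear_combination 2 * (2 * S 0 0 * p t α 1 - (S 0 1 + S 1 0) * p t α 0) * hr2

/-- **Time-derivative identity for the mean-curvature operator** (the identity used in
Section 6, stated in Section 1.3):
`∂_t[Σ_{i,j} ∂_i(√g g^{ij} ∂_jη^α)]
  = Σ_i ∂_i[√g g^{ij} Π^α_λ ∂_j v^λ
      + √g (g^{ij}g^{kl} − g^{lj}g^{ik}) ∂_jη^α ∂_kη_λ ∂_l v^λ]`. -/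
theorem mean_curvature_time_derivative
    (U : Set (Fin 2 → ℝ)) (hU : IsOpen U)
    (I : Set ℝ) (hIopen : IsOpen I) (hIconn : I.OrdConnected)
    (η : ℝ → (Fin 2 → ℝ) → (Fin 3 → ℝ))
    (hη : ContDiffOn ℝ 3 (Function.uncurry η) (I ×ˢ U))
    (hg : ∀ t ∈ I, ∀ y ∈ U, 0 < (metric (η t) y).det) :
    ∀ t ∈ I, ∀ y ∈ U, ∀ α : Fin 3,
      deriv (fun s => ∑ i : Fin 2, ∑ j : Fin 2,
          pd2 (fun z => Real.sqrt ((metric (η s) z).det) * (metric (η s) z)⁻¹ i j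
                * pd2 (fun w => η s w α) j z) i y) t
        = ∑ i : Fin 2,
            pd2 (fun z =>
                (∑ j : Fin 2, ∑ lam : Fin 3,
                  Real.sqrt ((metric (η t) z).det) * (metric (η t) z)⁻¹ i j
                    * tanProj (η t) z α lam * pd2 (fun w => tderiv2 η t w lam) j z)
              + (∑ j : Fin 2, ∑ k : Fin 2, ∑ l : Fin 2, ∑ lam : Fin 3,
                  Real.sqrt ((metric (η t) z).det)
                    * ((metric (η t) z)⁻¹ i j * (metric (η t) z)⁻¹ k l
                        - (metric (η t) z)⁻¹ l j * (metric (η t) z)⁻¹ i k)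
                    * pd2 (fun w => η t w α) j z * pd2 (fun w => η t w lam) k z
                    * pd2 (fun w => tderiv2 η t w lam) l z)) i y := by
  intro t ht y hy α
  have hV : ∀ s ∈ I, ∀ z ∈ U, ∀ a, ContDiffAt ℝ 3 (Function.uncurry fun r w => η r w a) (s, z) :=
    fun s hs z hz => contDiffAt_pi.1 (hη.contDiffAt ((hIopen.prod hU).mem_nhds ⟨hs, hz⟩))
  let P : ℝ × (Fin 2 → ℝ) → Fin 3 → Fin 2 → ℝ := fun x a j => pd2 (fun w => η x.1 w a) j x.2
  have hP : ∀ s ∈ I, ∀ z ∈ U, ∀ a j, ContDiffAt ℝ 2 (fun x => P x a j) (s, z) :=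
    fun s hs z hz a j => (hV s hs z hz a).fderiv_slice_apply (m := 2) (by norm_num) (by simp) _
  have hpos : ∀ s ∈ I, ∀ z ∈ U, 0 < (colGram (P (s, z))).det := hg
  have hterm : ∀ s ∈ I, ∀ z ∈ U, ∀ i j, ContDiffAt ℝ 2
      (fun x => √(colGram (P x)).det * (colGram (P x))⁻¹ i j * P x α j) (s, z) :=
    fun s hs z hz i j => contDiffAt_flux_term (hP s hs z hz) (hpos s hs z hz) i j α
  have hflux : ∀ i, ContDiffAt ℝ 2 (Function.uncurry fun s z => flux (P (s, z)) i α) (t, y) :=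
    fun i => ContDiffAt.sum (s := Finset.univ) fun j _ => hterm t ht y hy i j
  have hvel : ∀ z ∈ U, ∀ a j,
      HasDerivAt (fun s => P (s, z) a j) (pd2 (fun w => tderiv2 η t w a) j z) t := by
    intro z hz a j
    have h := hasDerivAt_fderiv_slice ((hV t ht z hz a).of_le (by norm_num)) (Pi.single j 1)
    have hcongr : (fun w => tderiv2 η t w a) =ᶠ[𝓝 z] fun w => deriv (fun s => η s w a) t := by
      filter_upwards [hU.mem_nhds hz] with w hw
      refine congrFun (deriv_pi fun b => ?_) a
      have hs : DifferentiableAt ℝ (fun s : ℝ => (s, w)) t := by fun_prop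
      exact ((hV t ht w hw b).differentiableAt (by simp)).comp t hs
    rw [pd2, hcongr.fderiv_eq]
    exact h
  have hlhs : (fun s => ∑ i, ∑ j, pd2 (fun z => √(metric (η s) z).det * (metric (η s) z)⁻¹ i j
        * pd2 (fun w => η s w α) j z) i y)
      =ᶠ[𝓝 t] fun s => ∑ i, fderiv ℝ (fun z => flux (P (s, z)) i α) y (Pi.single i 1) := by
    filter_upwards [hIopen.mem_nhds ht] with s hs
    refine Finset.sum_congr rfl fun i _ => ?_
    have hslice : DifferentiableAt ℝ (fun z : Fin 2 → ℝ => (s, z)) y := by fun_prop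
    have hsum := fderiv_fun_sum (u := Finset.univ) fun j _ =>
      ((hterm s hs y hy i j).differentiableAt (by simp)).comp y hslice
    have happ := congrArg (fun L : (Fin 2 → ℝ) →L[ℝ] ℝ => L (Pi.single i 1)) hsum
    simp only [sum_apply] at happ
    exact happ.symm
  rw [hlhs.deriv_eq,
    (HasDerivAt.fun_sum fun i _ => hasDerivAt_fderiv_slice (hflux i) (Pi.single i 1)).deriv]
  refine Finset.sum_congr rfl fun i _ => ?_
  refine congrArg (fun L : (Fin 2 → ℝ) →L[ℝ] ℝ => L (Pi.single i 1)) (EventuallyEq.fderiv_eq ?_)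
  filter_upwards [hU.mem_nhds hy] with z hz
  exact (hasDerivAt_flux (p := fun s => P (s, z)) (hvel z hz) (hpos t ht z hz) i α).deriv
end
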